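/- Any two Rado simplicial complexes are isomorphic. -/

import Mathlib

/-- An (abstract) simplicial complex with vertices drawn from `ℕ`:
a set of nonempty finite subsets of `ℕ` (the simplexes) closed under
passing to nonempty subsets.  The vertex set `V(X)` is the set of `v`
with `{v}` a simplex. -/
structure SComplex where
  faces : Set (Finset ℕ)
  nonempty_of_mem : ∀ s ∈ faces, s.Nonempty
  down_closed : ∀ s ∈ faces, ∀ t ⊆ s, t.Nonempty → t ∈ faces

namespace SComplex

/-- The vertex set of a simplicial complex. -/
def vertexSet (X : SComplex) : Set ℕ := {v | {v} ∈ X.faces}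

/-- The subcomplex of `X` induced on a set `U` of vertices. -/
def induced (X : SComplex) (U : Set ℕ) : SComplex where
  faces := {s | s ∈ X.faces ∧ (↑s : Set ℕ) ⊆ U}
  nonempty_of_mem := fun s hs => X.nonempty_of_mem s hs.1
  down_closed := fun s hs t hts ht =>
    ⟨X.down_closed s hs.1 t hts ht,
     fun x hx => hs.2 (Finset.mem_coe.mpr (hts (Finset.mem_coe.mp hx)))⟩

/-- The link of a vertex `v`: all simplexes `σ` with `v ∉ σ` and `σ ∪ {v}` a simplex. -/
def link (X : SComplex) (v : ℕ) : SComplex where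
  faces := {s | s ∈ X.faces ∧ v ∉ s ∧ insert v s ∈ X.faces}
  nonempty_of_mem := fun s hs => X.nonempty_of_mem s hs.1
  down_closed := fun s hs t hts ht =>
    ⟨X.down_closed s hs.1 t hts ht,
     fun hv => hs.2.1 (hts hv),
     X.down_closed _ hs.2.2 _ (Finset.insert_subset_insert v hts)
       (Finset.insert_nonempty v t)⟩

/-- `IsIso X Y f` : the map `f` is an isomorphism of simplicial complexes from `X` to `Y`,
i.e. a bijection of the vertex sets which induces a bijection between the sets of simplexes. -/
def IsIso (X Y : SComplex) (f : ℕ → ℕ) : Prop :=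
  Set.BijOn f X.vertexSet Y.vertexSet ∧
    ∀ s : Finset ℕ, (↑s : Set ℕ) ⊆ X.vertexSet → (s ∈ X.faces ↔ s.image f ∈ Y.faces)

/-- Two simplicial complexes are isomorphic. -/
def Isomorphic (X Y : SComplex) : Prop := ∃ f, IsIso X Y f

/-- `X` is universal: every countable simplicial complex is isomorphic to an induced
subcomplex of `X`. -/
def Universal (X : SComplex) : Prop :=
  ∀ Y : SComplex, Y.vertexSet.Countable →
    ∃ U ⊆ X.vertexSet, Isomorphic Y (X.induced U)

/-- `X` is homogeneous: every isomorphism between finite induced subcomplexes of `X`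
extends to an isomorphism of `X` onto itself. -/
def Homogeneous (X : SComplex) : Prop :=
  ∀ U U' : Set ℕ, U.Finite → U'.Finite → U ⊆ X.vertexSet → U' ⊆ X.vertexSet →
    ∀ f : ℕ → ℕ, IsIso (X.induced U) (X.induced U') f →
      ∃ F : ℕ → ℕ, IsIso X X F ∧ Set.EqOn F f U

/-- A Rado complex: a countable simplicial complex which is universal and homogeneous. -/
def IsRado (X : SComplex) : Prop :=
  X.vertexSet.Countable ∧ Universal X ∧ Homogeneous X

/-- The ampleness condition: for every finite `U ⊆ V(X)` and every subcomplex `A` of the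
induced complex `X_U` there is a vertex `v ∈ V(X) - U` with `Lk_X(v) ∩ X_U = A`. -/
def AmpleProp (X : SComplex) : Prop :=
  ∀ U : Set ℕ, U.Finite → U ⊆ X.vertexSet →
    ∀ A : SComplex, A.faces ⊆ (X.induced U).faces →
      ∃ v ∈ X.vertexSet \ U, (X.link v).faces ∩ (X.induced U).faces = A.faces

/-- An ample complex: a countable simplicial complex satisfying the ampleness condition. -/
def IsAmple (X : SComplex) : Prop := X.vertexSet.Countable ∧ AmpleProp X

/-- `L'` is an induced subcomplex of `L`. -/
def IsInduced (L' L : SComplex) : Prop :=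
  L'.faces ⊆ L.faces ∧ ∀ s ∈ L.faces, (↑s : Set ℕ) ⊆ L'.vertexSet → s ∈ L'.faces

end SComplex

namespace SComplex

lemma mem_vertexSet {X : SComplex} {s : Finset ℕ} (hs : s ∈ X.faces) {v : ℕ} (hv : v ∈ s) :
    v ∈ X.vertexSet :=
  X.down_closed s hs {v} (Finset.singleton_subset_iff.2 hv) (Finset.singleton_nonempty v)

lemma coe_subset_vertexSet {X : SComplex} {s : Finset ℕ} (hs : s ∈ X.faces) :
    (↑s : Set ℕ) ⊆ X.vertexSet :=
  fun _ hv => mem_vertexSet hs hv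

lemma vertexSet_induced {X : SComplex} {U : Set ℕ} (hU : U ⊆ X.vertexSet) :
    (X.induced U).vertexSet = U := by
  ext v
  simp only [vertexSet, induced, Set.mem_ofPred_eq, Finset.coe_singleton,
    Set.singleton_subset_iff]
  exact ⟨fun h => h.2, fun h => ⟨hU h, h⟩⟩

lemma induced_vertexSet (X : SComplex) : X.induced X.vertexSet = X := by
  have h : (X.induced X.vertexSet).faces = X.faces :=
    Set.ext fun s => ⟨fun hs => hs.1, fun hs => ⟨hs, coe_subset_vertexSet hs⟩⟩
  cases X
  simpa [induced] using h

/-- `f` maps `X` isomorphically onto an induced subcomplex of `Y`. -/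
structure IsEmbedding (X Y : SComplex) (f : ℕ → ℕ) : Prop where
  mapsTo : Set.MapsTo f X.vertexSet Y.vertexSet
  injOn : Set.InjOn f X.vertexSet
  mem_faces_iff : ∀ s : Finset ℕ, (↑s : Set ℕ) ⊆ X.vertexSet →
    (s ∈ X.faces ↔ s.image f ∈ Y.faces)

lemma IsIso.isEmbedding {X Y : SComplex} {f : ℕ → ℕ} (h : IsIso X Y f) : IsEmbedding X Y f :=
  ⟨h.1.mapsTo, h.1.injOn, h.2⟩

lemma Universal.exists_isEmbedding {X Y : SComplex} (hY : Y.Universal)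
    (hX : X.vertexSet.Countable) : ∃ f, IsEmbedding X Y f := by
  obtain ⟨U, hU, f, hf, hfaces⟩ := hY X hX
  rw [vertexSet_induced hU] at hf
  refine ⟨f, fun x hx => hU (hf.mapsTo hx), hf.injOn, fun s hs => ?_⟩
  rw [hfaces s hs]
  refine ⟨fun h => h.1, fun h => ⟨h, ?_⟩⟩
  rw [Finset.coe_image]
  exact (hf.mapsTo.mono_left hs).image_subset

/-- `P` is the graph of an isomorphism between induced subcomplexes of `X` and of `Y`. -/
structure IsPartialIso (X Y : SComplex) (P : Set (ℕ × ℕ)) : Prop where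
  fst_mem : ∀ a ∈ P, a.1 ∈ X.vertexSet
  snd_mem : ∀ a ∈ P, a.2 ∈ Y.vertexSet
  eq_iff : ∀ a ∈ P, ∀ b ∈ P, a.1 = b.1 ↔ a.2 = b.2
  mem_faces_iff : ∀ t : Finset (ℕ × ℕ), ↑t ⊆ P →
    (t.image Prod.fst ∈ X.faces ↔ t.image Prod.snd ∈ Y.faces)

namespace IsPartialIso

variable {X Y Z : SComplex} {P : Set (ℕ × ℕ)}

lemma empty (X Y : SComplex) : IsPartialIso X Y ∅ := by
  refine ⟨by simp, by simp, by simp, fun t ht => ?_⟩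
  have : t = ∅ := by simpa using ht
  subst this
  exact ⟨fun h => by simpa using X.nonempty_of_mem _ h,
    fun h => by simpa using Y.nonempty_of_mem _ h⟩

lemma swap (h : IsPartialIso X Y P) : IsPartialIso Y X (Prod.swap '' P) := by
  refine ⟨?_, ?_, ?_, fun t ht => ?_⟩
  · rintro _ ⟨a, ha, rfl⟩
    exact h.snd_mem a ha
  · rintro _ ⟨a, ha, rfl⟩
    exact h.fst_mem a ha
  · rintro _ ⟨a, ha, rfl⟩ _ ⟨b, hb, rfl⟩
    exact (h.eq_iff a ha b hb).symm
  · obtain ⟨s, hs, rfl⟩ := Finset.subset_set_image_iff.1 ht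
    simpa [Finset.image_image, Function.comp_def] using (h.mem_faces_iff s hs).symm

lemma map_snd (h : IsPartialIso X Y P) {g : ℕ → ℕ} (hg : IsEmbedding Y Z g) :
    IsPartialIso X Z ((fun a => (a.1, g a.2)) '' P) := by
  refine ⟨?_, ?_, ?_, fun t ht => ?_⟩
  · rintro _ ⟨a, ha, rfl⟩
    exact h.fst_mem a ha
  · rintro _ ⟨a, ha, rfl⟩
    exact hg.mapsTo (h.snd_mem a ha)
  · rintro _ ⟨a, ha, rfl⟩ _ ⟨b, hb, rfl⟩
    exact (h.eq_iff a ha b hb).trans (hg.injOn.eq_iff (h.snd_mem a ha) (h.snd_mem b hb)).symm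
  · obtain ⟨s, hs, rfl⟩ := Finset.subset_set_image_iff.1 ht
    have hs' : (↑(s.image Prod.snd) : Set ℕ) ⊆ Y.vertexSet := by
      intro y hy
      obtain ⟨a, ha, rfl⟩ := Finset.mem_image.1 (Finset.mem_coe.1 hy)
      exact h.snd_mem a (hs ha)
    have := (h.mem_faces_iff s hs).trans (hg.mem_faces_iff _ hs')
    simpa [Finset.image_image, Function.comp_def] using this

lemma of_isEmbedding {f g : ℕ → ℕ} (hf : IsEmbedding X Z f) (hg : IsEmbedding Y Z g)
    (hX : ∀ a ∈ P, a.1 ∈ X.vertexSet) (hY : ∀ a ∈ P, a.2 ∈ Y.vertexSet)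
    (hfg : ∀ a ∈ P, f a.1 = g a.2) : IsPartialIso X Y P := by
  refine ⟨hX, hY, fun a ha b hb => ?_, fun t ht => ?_⟩
  · rw [← hf.injOn.eq_iff (hX a ha) (hX b hb), ← hg.injOn.eq_iff (hY a ha) (hY b hb),
      hfg a ha, hfg b hb]
  · rw [hf.mem_faces_iff, hg.mem_faces_iff, Finset.image_image, Finset.image_image,
      Finset.image_congr (f := f ∘ Prod.fst) (g := g ∘ Prod.snd) fun a ha => hfg a (ht ha)]
    · intro y hy
      obtain ⟨a, ha, rfl⟩ := Finset.mem_image.1 (Finset.mem_coe.1 hy)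
      exact hY a (ht ha)
    · intro y hy
      obtain ⟨a, ha, rfl⟩ := Finset.mem_image.1 (Finset.mem_coe.1 hy)
      exact hX a (ht ha)

lemma sUnion {C : Set (Set (ℕ × ℕ))} (hne : C.Nonempty) (hdir : DirectedOn (· ⊆ ·) C)
    (hC : ∀ P ∈ C, IsPartialIso X Y P) : IsPartialIso X Y (⋃₀ C) := by
  have key : ∀ t : Finset (ℕ × ℕ), ↑t ⊆ ⋃₀ C → ∃ P ∈ C, ↑t ⊆ P := fun t ht =>
    hdir.exists_mem_subset_of_finite_of_subset_sUnion hne t.finite_toSet ht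
  refine ⟨?_, ?_, fun a ha b hb => ?_, fun t ht => ?_⟩
  · rintro a ⟨P, hP, ha⟩
    exact (hC P hP).fst_mem a ha
  · rintro a ⟨P, hP, ha⟩
    exact (hC P hP).snd_mem a ha
  · obtain ⟨P, hP, hab⟩ := key {a, b} (by simp [Set.insert_subset_iff, -Set.mem_sUnion, ha, hb])
    exact (hC P hP).eq_iff a (hab (by simp)) b (hab (by simp))
  · obtain ⟨P, hP, htP⟩ := key t ht
    exact (hC P hP).mem_faces_iff t htP

lemma exists_isIso (h : IsPartialIso X Y P) :
    ∃ f : ℕ → ℕ, (∀ a ∈ P, f a.1 = a.2) ∧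
      IsIso (X.induced (Prod.fst '' P)) (Y.induced (Prod.snd '' P)) f := by
  have hfun : ∀ x, ∃ y, ∀ a ∈ P, a.1 = x → a.2 = y := by
    intro x
    by_cases hx : ∃ a ∈ P, a.1 = x
    · obtain ⟨a, ha, rfl⟩ := hx
      exact ⟨a.2, fun b hb hab => (h.eq_iff b hb a ha).1 hab⟩
    · exact ⟨0, fun a ha hax => absurd ⟨a, ha, hax⟩ hx⟩
  choose f hf using hfun
  have hf : ∀ a ∈ P, f a.1 = a.2 := fun a ha => (hf a.1 a ha rfl).symm
  refine ⟨f, hf, ?_, fun s hs => ?_⟩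
  · rw [vertexSet_induced (Set.image_subset_iff.2 h.fst_mem),
      vertexSet_induced (Set.image_subset_iff.2 h.snd_mem)]
    refine ⟨?_, ?_, ?_⟩
    · rintro _ ⟨a, ha, rfl⟩
      exact ⟨a, ha, (hf a ha).symm⟩
    · rintro _ ⟨a, ha, rfl⟩ _ ⟨b, hb, rfl⟩ hab
      rw [hf a ha, hf b hb] at hab
      exact (h.eq_iff a ha b hb).2 hab
    · rintro _ ⟨a, ha, rfl⟩
      exact ⟨a.1, ⟨a, ha, rfl⟩, hf a ha⟩
  · rw [vertexSet_induced (Set.image_subset_iff.2 h.fst_mem)] at hs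
    obtain ⟨t, ht, rfl⟩ := Finset.subset_set_image_iff.1 hs
    have himage : (t.image Prod.fst).image f = t.image Prod.snd := by
      rw [Finset.image_image]
      exact Finset.image_congr fun a ha => hf a (ht ha)
    rw [himage]
    have hsnd : (↑(t.image Prod.snd) : Set ℕ) ⊆ Prod.snd '' P := by
      rw [Finset.coe_image]
      exact Set.image_mono ht
    exact ⟨fun H => ⟨(h.mem_faces_iff t ht).1 H.1, hsnd⟩,
      fun H => ⟨(h.mem_faces_iff t ht).2 H.1, hs⟩⟩

/-- The forth step of the back-and-forth construction. -/
lemma exists_insert_fst (h : IsPartialIso X Y P) (hP : P.Finite) (hX : X.vertexSet.Countable)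
    (huniv : Y.Universal) (hhom : Y.Homogeneous) {x : ℕ} (hx : x ∈ X.vertexSet) :
    ∃ y, IsPartialIso X Y (insert (x, y) P) := by
  obtain ⟨g, hg⟩ := huniv.exists_isEmbedding hX
  have hQ := h.swap.map_snd hg
  obtain ⟨f, hf, hiso⟩ := hQ.exists_isIso
  have hfin := (hP.image Prod.swap).image fun a => (a.1, g a.2)
  obtain ⟨F, hF, hFf⟩ := hhom _ _ (hfin.image _) (hfin.image _)
    (Set.image_subset_iff.2 hQ.fst_mem) (Set.image_subset_iff.2 hQ.snd_mem) f hiso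
  obtain ⟨y, hy, hFy⟩ := hF.1.surjOn (hg.mapsTo hx)
  refine ⟨y, of_isEmbedding hg hF.isEmbedding ?_ ?_ ?_⟩
  · exact Set.forall_mem_insert.2 ⟨hx, h.fst_mem⟩
  · exact Set.forall_mem_insert.2 ⟨hy, h.snd_mem⟩
  · refine Set.forall_mem_insert.2 ⟨hFy.symm, fun a ha => ?_⟩
    have hmem : (a.2, g a.1) ∈ (fun a : ℕ × ℕ => (a.1, g a.2)) '' (Prod.swap '' P) :=
      ⟨a.swap, ⟨a, ha, rfl⟩, rfl⟩
    rw [hFf ⟨_, hmem, rfl⟩]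
    exact (hf _ hmem).symm

/-- The back step of the back-and-forth construction. -/
lemma exists_insert_snd (h : IsPartialIso X Y P) (hP : P.Finite) (hY : Y.vertexSet.Countable)
    (huniv : X.Universal) (hhom : X.Homogeneous) {y : ℕ} (hy : y ∈ Y.vertexSet) :
    ∃ x, IsPartialIso X Y (insert (x, y) P) := by
  obtain ⟨x, hx⟩ := h.swap.exists_insert_fst (hP.image _) hY huniv hhom hy
  refine ⟨x, ?_⟩
  simpa [Set.image_insert_eq, Set.image_image] using hx.swap

end IsPartialIso

end SComplex

/-- Any two Rado simplicial complexes are isomorphic. -/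
theorem rado_unique (X Y : SComplex) (hX : X.IsRado) (hY : Y.IsRado) :
    X.Isomorphic Y := by
  let C : Type := {P : Set (ℕ × ℕ) // P.Finite ∧ SComplex.IsPartialIso X Y P}
  let D : X.vertexSet ⊕ Y.vertexSet → Order.Cofinal C := Sum.elim
    (fun x =>
      { carrier := {P | x.1 ∈ Prod.fst '' P.1}
        isCofinal := fun P => by
          obtain ⟨y, hy⟩ := P.2.2.exists_insert_fst P.2.1 hX.1 hY.2.1 hY.2.2 x.2
          exact ⟨⟨_, P.2.1.insert _, hy⟩, ⟨_, Set.mem_insert _ _, rfl⟩, Set.subset_insert _ _⟩ })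
    (fun y =>
      { carrier := {P | y.1 ∈ Prod.snd '' P.1}
        isCofinal := fun P => by
          obtain ⟨x, hx⟩ := P.2.2.exists_insert_snd P.2.1 hY.1 hX.2.1 hX.2.2 y.2
          exact ⟨⟨_, P.2.1.insert _, hx⟩, ⟨_, Set.mem_insert _ _, rfl⟩, Set.subset_insert _ _⟩ })
  have : Encodable (X.vertexSet ⊕ Y.vertexSet) := Encodable.ofCountable _
  let I : Order.Ideal C := Order.idealOfCofinals ⟨∅, Set.finite_empty, .empty X Y⟩ D
  have hI : SComplex.IsPartialIso X Y (⋃₀ (Subtype.val '' (I : Set C))) := by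
    refine .sUnion (I.nonempty.image _) ?_ ?_
    · rintro _ ⟨P, hP, rfl⟩ _ ⟨Q, hQ, rfl⟩
      obtain ⟨R, hR, hPR, hQR⟩ := I.directed P hP Q hQ
      exact ⟨R.1, ⟨R, hR, rfl⟩, hPR, hQR⟩
    · rintro _ ⟨P, -, rfl⟩
      exact P.2.2
  obtain ⟨f, -, hf⟩ := hI.exists_isIso
  have hfst : Prod.fst '' (⋃₀ (Subtype.val '' (I : Set C))) = X.vertexSet := by
    refine Set.Subset.antisymm (b := X.vertexSet) (Set.image_subset_iff.2 hI.fst_mem)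
      fun x hx => ?_
    obtain ⟨P, ⟨a, ha, hax⟩, hP⟩ := Order.cofinal_meets_idealOfCofinals
      ⟨∅, Set.finite_empty, .empty X Y⟩ D (.inl ⟨x, hx⟩)
    exact ⟨a, ⟨P.1, ⟨P, hP, rfl⟩, ha⟩, hax⟩
  have hsnd : Prod.snd '' (⋃₀ (Subtype.val '' (I : Set C))) = Y.vertexSet := by
    refine Set.Subset.antisymm (b := Y.vertexSet) (Set.image_subset_iff.2 hI.snd_mem)
      fun y hy => ?_
    obtain ⟨P, ⟨a, ha, hay⟩, hP⟩ := Order.cofinal_meets_idealOfCofinals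
      ⟨∅, Set.finite_empty, .empty X Y⟩ D (.inr ⟨y, hy⟩)
    exact ⟨a, ⟨P.1, ⟨P, hP, rfl⟩, ha⟩, hay⟩
  rw [hfst, hsnd, SComplex.induced_vertexSet, SComplex.induced_vertexSet] at hf
  exact ⟨f, hf⟩
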